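/- arXiv:1702.02459 — 2 statements merged into one kernel-verified Lean document; each statement's English description precedes it below -/
import Mathlib

section
/- The Zeeman topology Z on Minkowski space M = ℝ⁴ induces the 3-dimensional Euclidean topology on every space axis; that is, for every space axis A = x + W, where W is a 3-dimensional linear subspace of ℝ⁴ on which Q is negative definite, the subspace topology that Z induces on A coincides with the subspace topology that the Euclidean topology induces on A. -/
noncomputable section

/-- Minkowski space: `ℝ⁴` with the Euclidean (norm) topology as its
standard topology. -/
abbrev M4 : Type := EuclideanSpace ℝ (Fin 4)

/-- The Minkowski quadratic form `Q(x) = x₀² − x₁² − x₂² − x₃²`. -/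
def Q (x : M4) : ℝ := x 0 ^ 2 - x 1 ^ 2 - x 2 ^ 2 - x 3 ^ 2

/-- The light cone of a point `x`. -/
def lightCone (x : M4) : Set M4 := {y : M4 | y ≠ x ∧ Q (y - x) = 0}

/-- The basic Zeeman neighbourhood `(B_E(x,r) \ N(x)) ∪ {x}`. -/
def zeemanBall (x : M4) (r : ℝ) : Set M4 :=
  (Metric.ball x r \ lightCone x) ∪ {x}

/-- The Zeeman topology `Z`, generated by the sets `(B_E(x,r) \ N(x)) ∪ {x}`. -/
def Ztop : TopologicalSpace M4 :=
  TopologicalSpace.generateFrom {s : Set M4 | ∃ x : M4, ∃ r : ℝ, 0 < r ∧ s = zeemanBall x r}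

theorem continuous_Q : Continuous Q := by
  unfold Q
  fun_prop

theorem Ztop_le_euclidean : Ztop ≤ (inferInstance : TopologicalSpace M4) := by
  intro U hU
  refine (@isOpen_iff_forall_mem_open M4 Ztop U).2 fun p hp => ?_
  obtain ⟨r, hr, hrU⟩ := Metric.isOpen_iff.1 hU p hp
  refine ⟨zeemanBall p r, ?_, TopologicalSpace.isOpen_generateFrom_of_mem ⟨p, r, hr, rfl⟩,
    Or.inr rfl⟩
  rintro q (hq | rfl)
  · exact hrU hq.1
  · exact hp

/-- A Zeeman neighbourhood centred on a set without lightlike separated points meets it in a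
Euclidean ball. -/
theorem zeemanBall_inter_of_mem {A : Set M4} {y : M4} (hA : Disjoint A (lightCone y))
    {r : ℝ} (hr : 0 < r) : A ∩ zeemanBall y r = A ∩ Metric.ball y r := by
  ext p
  refine and_congr_right fun hp => ⟨?_, fun h => Or.inl ⟨h, hA.notMem_of_mem_left hp⟩⟩
  rintro (h | rfl)
  · exact h.1
  · exact Metric.mem_ball_self hr

/-- A Zeeman neighbourhood centred off a set meets it in a relatively Euclidean-open set. -/
theorem zeemanBall_inter_of_notMem {A : Set M4} {y : M4} (hy : y ∉ A) (r : ℝ) :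
    A ∩ zeemanBall y r = A ∩ (Metric.ball y r ∩ {p | Q (p - y) ≠ 0}) := by
  ext p
  refine and_congr_right fun hp => ?_
  have hpy : p ≠ y := fun h => hy (h ▸ hp)
  simp [zeemanBall, lightCone, hpy]

/-- The Zeeman and Euclidean topologies agree on sets without lightlike separated points. -/
theorem induced_Ztop_eq_of_disjoint_lightCone {A : Set M4}
    (hA : ∀ y ∈ A, Disjoint A (lightCone y)) :
    TopologicalSpace.induced (Subtype.val : A → M4) Ztop =
      TopologicalSpace.induced (Subtype.val : A → M4) inferInstance := by
  refine le_antisymm (induced_mono Ztop_le_euclidean) ?_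
  rw [Ztop, induced_generateFrom_eq]
  refine le_generateFrom ?_
  rintro _ ⟨_, ⟨y, r, hr, rfl⟩, rfl⟩
  by_cases hy : y ∈ A
  · exact ⟨Metric.ball y r, Metric.isOpen_ball,
      (Subtype.preimage_val_eq_preimage_val_iff _ _ _).2
        (zeemanBall_inter_of_mem (hA y hy) hr).symm⟩
  · refine ⟨Metric.ball y r ∩ {p | Q (p - y) ≠ 0}, Metric.isOpen_ball.inter ?_,
      (Subtype.preimage_val_eq_preimage_val_iff _ _ _).2
        (zeemanBall_inter_of_notMem hy r).symm⟩
    exact isOpen_ne_fun (continuous_Q.comp (continuous_id.sub continuous_const)) continuous_const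

/-- On every space axis `A = x + W`, where `W` is a 3-dimensional subspace of
`ℝ⁴` on which `Q` is negative definite, the Zeeman topology `Z` induces the
same subspace topology as the Euclidean topology, namely the 3-dimensional
Euclidean topology. -/
theorem zeeman_induces_euclidean_on_space_axes :
    ∀ (x : M4) (W : Submodule ℝ M4), Module.finrank ℝ W = 3 →
      (∀ w ∈ W, w ≠ 0 → Q w < 0) →
      TopologicalSpace.induced
          (Subtype.val : {p : M4 | ∃ w ∈ W, p = x + w} → M4) Ztop =
      TopologicalSpace.induced
          (Subtype.val : {p : M4 | ∃ w ∈ W, p = x + w} → M4)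
          inferInstance := by
  intro x W _ hW
  refine induced_Ztop_eq_of_disjoint_lightCone ?_
  rintro _ ⟨v, hv, rfl⟩
  refine Set.disjoint_left.2 ?_
  rintro _ ⟨w, hw, rfl⟩ ⟨hne, hQ⟩
  rw [add_sub_add_left_eq_sub] at hQ
  exact (hW _ (W.sub_mem hw hv) (sub_ne_zero.2 fun h => hne (h ▸ rfl))).ne hQ
end
end

section
/- Minkowski space M = ℝ⁴ equipped with the fine Zeeman topology F is not first countable: no point of M has a countable neighborhood basis for F. -/
noncomputable section

/-- `A` is a time axis (a line with timelike direction) or a space axis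
(a translate of a 3-dimensional subspace on which `Q` is negative definite). -/
def IsAxis (A : Set M4) : Prop :=
  (∃ x v : M4, 0 < Q v ∧ A = {p : M4 | ∃ t : ℝ, p = x + t • v}) ∨
  (∃ (x : M4) (W : Submodule ℝ M4), Module.finrank ℝ W = 3 ∧
    (∀ w ∈ W, w ≠ 0 → Q w < 0) ∧ A = {p : M4 | ∃ w ∈ W, p = x + w})

/-- The fine Zeeman topology `F`: the finest topology on `M4` inducing the
Euclidean subspace topology on every time axis and every space axis.
A set `U` is `F`-open iff its preimage in every axis `A` (with the Euclidean
subspace topology) is open. -/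
def Ftop : TopologicalSpace M4 :=
  ⨆ A : {A : Set M4 // IsAxis A},
    TopologicalSpace.coinduced (Subtype.val : A.1 → M4) inferInstance

/-- A set is open for the fine Zeeman topology iff its trace on every axis is open. -/
theorem isOpen_Ftop_iff {U : Set M4} :
    @IsOpen M4 Ftop U ↔ ∀ A : Set M4, IsAxis A → IsOpen ((↑) ⁻¹' U : Set A) := by
  unfold Ftop
  rw [isOpen_iSup_iff, Subtype.forall]
  rfl

/-- Timelike lines are continuous for the fine Zeeman topology. -/
theorem continuous_line_Ftop (x : M4) {v : M4} (hv : 0 < Q v) :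
    @Continuous ℝ M4 _ Ftop fun t : ℝ => x + t • v := by
  refine (@continuous_def ℝ M4 _ Ftop _).2 fun U hU => ?_
  have h := isOpen_Ftop_iff.1 hU _ (Or.inl ⟨x, v, hv, rfl⟩)
  have hc : Continuous fun t : ℝ =>
      (⟨x + t • v, t, rfl⟩ : {p : M4 | ∃ t : ℝ, p = x + t • v}) :=
    Continuous.subtype_mk (by fun_prop) _
  exact h.preimage hc

theorem Q_smul (t : ℝ) (v : M4) : Q (t • v) = t ^ 2 * Q v := by
  simp only [Q, PiLp.smul_apply, smul_eq_mul]
  ring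

/-- Pairwise non-parallel timelike vectors. -/
def slopeVec (n : ℕ) : M4 := !₂[1, 1 / ((n : ℝ) + 2), 0, 0]

theorem one_div_add_two_lt_one (n : ℕ) : 1 / ((n : ℝ) + 2) < 1 := by
  rw [div_lt_one (by positivity)]
  linarith [(Nat.cast_nonneg n : (0 : ℝ) ≤ n)]

theorem Q_slopeVec_pos (n : ℕ) : 0 < Q (slopeVec n) := by
  have h0 : 0 < 1 / ((n : ℝ) + 2) := by positivity
  have h1 := one_div_add_two_lt_one n
  have h : Q (slopeVec n) = 1 - (1 / ((n : ℝ) + 2)) ^ 2 := by simp [Q, slopeVec]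
  rw [h]
  nlinarith

theorem norm_slopeVec_le (n : ℕ) : ‖slopeVec n‖ ≤ 2 := by
  have h0 : 0 < 1 / ((n : ℝ) + 2) := by positivity
  have h1 := one_div_add_two_lt_one n
  have h : ‖slopeVec n‖ ^ 2 = 1 + (1 / ((n : ℝ) + 2)) ^ 2 := by
    simp [EuclideanSpace.norm_sq_eq, slopeVec, Fin.sum_univ_four]
  nlinarith [norm_nonneg (slopeVec n)]

/-- Nonzero multiples of distinct `slopeVec`s are never parallel. -/
theorem eq_of_smul_slopeVec {m n : ℕ} {a b c d : ℝ} {w : M4} (ha : a ≠ 0) (hb : b ≠ 0)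
    (hm : a • slopeVec m = c • w) (hn : b • slopeVec n = d • w) : m = n := by
  have hm0 : a = c * w 0 := by simpa [slopeVec] using congrArg (fun p : M4 => p 0) hm
  have hm1 : a * ((m : ℝ) + 2)⁻¹ = c * w 1 := by
    simpa [slopeVec] using congrArg (fun p : M4 => p 1) hm
  have hn0 : b = d * w 0 := by simpa [slopeVec] using congrArg (fun p : M4 => p 0) hn
  have hn1 : b * ((n : ℝ) + 2)⁻¹ = d * w 1 := by
    simpa [slopeVec] using congrArg (fun p : M4 => p 1) hn
  have hprod : a * b * ((m : ℝ) + 2)⁻¹ = a * b * ((n : ℝ) + 2)⁻¹ := by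
    calc a * b * ((m : ℝ) + 2)⁻¹ = b * (a * ((m : ℝ) + 2)⁻¹) := by ring
      _ = d * w 0 * (c * w 1) := by rw [hm1, ← hn0]
      _ = c * w 0 * (d * w 1) := by ring
      _ = a * (b * ((n : ℝ) + 2)⁻¹) := by rw [hn1, ← hm0]
      _ = a * b * ((n : ℝ) + 2)⁻¹ := by ring
  have h := inv_injective (mul_left_cancel₀ (mul_ne_zero ha hb) hprod)
  exact_mod_cast add_right_cancel h

/-- An axis through `x` contains at most one of the points `x + t n • slopeVec n`. -/
theorem IsAxis.subsingleton_inter_range {A : Set M4} (hA : IsAxis A) {x : M4} (hx : x ∈ A)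
    {t : ℕ → ℝ} (ht : ∀ n, 0 < t n) :
    (A ∩ Set.range fun n => x + t n • slopeVec n).Subsingleton := by
  rintro _ ⟨hpA, m, rfl⟩ _ ⟨hqA, n, rfl⟩
  rcases hA with ⟨y, w, -, rfl⟩ | ⟨y, W, -, hW, rfl⟩
  · obtain ⟨r, hr⟩ := hx
    obtain ⟨a, ha⟩ := hpA
    obtain ⟨b, hb⟩ := hqA
    dsimp only at ha hb
    have hm : t m • slopeVec m = (a - r) • w := by
      rw [sub_smul, ← add_sub_add_left_eq_sub _ _ y, ← ha, ← hr, add_sub_cancel_left]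
    have hn : t n • slopeVec n = (b - r) • w := by
      rw [sub_smul, ← add_sub_add_left_eq_sub _ _ y, ← hb, ← hr, add_sub_cancel_left]
    rw [eq_of_smul_slopeVec (ht m).ne' (ht n).ne' hm hn]
  · obtain ⟨u, hu, hxu⟩ := hx
    obtain ⟨w, hw, hxw⟩ := hpA
    dsimp only at hxw
    have hm : t m • slopeVec m = w - u := by
      rw [← add_sub_add_left_eq_sub _ _ y, ← hxw, ← hxu, add_sub_cancel_left]
    have hpos : 0 < Q (w - u) := by
      rw [← hm, Q_smul]
      exact mul_pos (pow_pos (ht m) 2) (Q_slopeVec_pos m)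
    have hne : w - u ≠ 0 := by
      intro h
      simp [h, Q] at hpos
    exact absurd (hW _ (W.sub_mem hw hu) hne) hpos.not_gt

/-- A sequence converging to `x` along pairwise distinct timelike directions is closed for the
fine Zeeman topology. -/
theorem isOpen_Ftop_compl_range (x : M4) {t : ℕ → ℝ} (ht0 : ∀ n, 0 < t n)
    (ht1 : ∀ n, t n < 1 / ((n : ℝ) + 1)) :
    @IsOpen M4 Ftop (Set.range fun n => x + t n • slopeVec n)ᶜ := by
  refine isOpen_Ftop_iff.2 fun A hA => ?_
  rw [Set.preimage_compl, isOpen_compl_iff]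
  by_cases hx : x ∈ A
  · refine Set.Subsingleton.isClosed fun p hp q hq => Subtype.ext ?_
    exact hA.subsingleton_inter_range hx ht0 ⟨p.2, hp⟩ ⟨q.2, hq⟩
  · have ht : Filter.Tendsto t Filter.atTop (nhds 0) :=
      squeeze_zero (fun n => (ht0 n).le) (fun n => (ht1 n).le)
        tendsto_one_div_add_atTop_nhds_zero_nat
    have hv : Filter.Tendsto (fun n => t n • slopeVec n) Filter.atTop (nhds 0) := by
      refine squeeze_zero_norm (fun n => ?_) (by simpa using ht.mul_const 2)
      rw [norm_smul, Real.norm_of_nonneg (ht0 n).le]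
      exact mul_le_mul_of_nonneg_left (norm_slopeVec_le n) (ht0 n).le
    have hp : Filter.Tendsto (fun n => x + t n • slopeVec n) Filter.atTop (nhds x) := by
      simpa using hv.const_add x
    convert hp.isCompact_insert_range.isClosed.preimage (continuous_subtype_val (p := (· ∈ A)))
      using 1
    ext p
    have hpx : (p : M4) ≠ x := fun h => hx (h ▸ p.2)
    simp [hpx]

/-- Minkowski space with the fine Zeeman topology `F` is not first countable:
no point has a countable neighbourhood basis, i.e. for no point is the
`F`-neighbourhood filter countably generated. -/
theorem fine_zeeman_not_firstCountable :
    ∀ x : M4, ¬ (@nhds M4 Ftop x).IsCountablyGenerated := by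
  intro x hx
  obtain ⟨U, hU⟩ := (@nhds M4 Ftop x).exists_antitone_basis
  have key : ∀ n : ℕ, ∃ t : ℝ, 0 < t ∧ t < 1 / ((n : ℝ) + 1) ∧ x + t • slopeVec n ∈ U n := by
    intro n
    have hc := continuous_line_Ftop x (Q_slopeVec_pos n)
    have h := (@Continuous.tendsto' ℝ M4 _ Ftop _ hc 0 x (by simp)).eventually (hU.mem n)
    have hpos : (0 : ℝ) < 1 / ((n : ℝ) + 1) := by positivity
    obtain ⟨t, hmem, h0, h1⟩ :=
      ((h.filter_mono nhdsWithin_le_nhds).and (Ioo_mem_nhdsGT hpos)).exists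
    exact ⟨t, h0, h1, hmem⟩
  choose t ht0 ht1 hmem using key
  have hopen := isOpen_Ftop_compl_range x ht0 ht1
  obtain ⟨n, hn⟩ := hU.mem_iff.1 <| @IsOpen.mem_nhds M4 Ftop x _ hopen <| by
    rintro ⟨n, hn⟩
    have h : t n • slopeVec n = 0 := by simpa using hn
    have h0 := congrArg (fun p : M4 => p 0) h
    simp [slopeVec, (ht0 n).ne'] at h0
  exact hn (hmem n) ⟨n, rfl⟩
end
end
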